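/- arXiv:2212.02680 — 3 statements merged into one kernel-verified Lean document; each statement's English description precedes it below -/
import Mathlib

section
/- Let X be a compact metric space, P and Q weak*-compact subsets of Δ(X), and ε > 0. Then exactly one of the following holds: (I) there exists a continuous function f : X → ℝ with ‖f‖_∞ = 1 such that ∫_X f dP − ∫_X f dQ > ε for all P ∈ P and all Q ∈ Q; or (II) there exist P in the closed convex hull of P and Q in the closed convex hull of Q with ‖P − Q‖₁ ≤ ε. (Never both.) -/
open MeasureTheory
open scoped NNReal

noncomputable section

/-- Total variation distance between two finite measures. -/
def tvDist {X : Type*} [MeasurableSpace X] (P Q : FiniteMeasure X) : ℝ :=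
  ((P.toMeasure.toSignedMeasure - Q.toMeasure.toSignedMeasure).totalVariation Set.univ).toReal

/-- Closed convex hull (weak* topology) of a set of probability measures, inside finite measures. -/
def cchull {X : Type*} [MeasurableSpace X] [TopologicalSpace X] [OpensMeasurableSpace X]
    (S : Set (ProbabilityMeasure X)) : Set (FiniteMeasure X) :=
  closure (convexHull ℝ≥0 (ProbabilityMeasure.toFiniteMeasure '' S))

lemma tvDist_eq {X : Type*} [MeasurableSpace X] (P Q : FiniteMeasure X) :
    tvDist P Q = (P.toMeasure - Q.toMeasure).real Set.univ +
      (Q.toMeasure - P.toMeasure).real Set.univ := by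
  rw [tvDist, SignedMeasure.totalVariation, Measure.toJordanDecomposition_toSignedMeasure_sub,
    Measure.jordanDecompositionOfToSignedMeasureSub_posPart,
    Measure.jordanDecompositionOfToSignedMeasureSub_negPart, Measure.add_apply,
    ENNReal.toReal_add (measure_ne_top _ _) (measure_ne_top _ _)]
  rfl

lemma add_sub_eq_add_sub_measure {X : Type*} [MeasurableSpace X] (μ ν : Measure X)
    [IsFiniteMeasure μ] [IsFiniteMeasure ν] : μ + (ν - μ) = ν + (μ - ν) := by
  rw [← Measure.toSignedMeasure_eq_toSignedMeasure_iff, Measure.toSignedMeasure_add,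
    Measure.toSignedMeasure_add, add_comm ν.toSignedMeasure, ← sub_eq_sub_iff_add_eq_add]
  exact Measure.sub_toSignedMeasure_eq_toSignedMeasure_sub

lemma norm_integral_continuousMap_le {X : Type*} [TopologicalSpace X] [CompactSpace X]
    [MeasurableSpace X] (μ : Measure X) [IsFiniteMeasure μ] (f : C(X, ℝ)) :
    ‖∫ x, f x ∂μ‖ ≤ μ.real Set.univ * ‖f‖ := by
  rw [mul_comm]
  exact norm_integral_le_of_norm_le_const (.of_forall f.norm_coe_le_norm)

lemma subset_cchull {X : Type*} [TopologicalSpace X] [MeasurableSpace X]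
    [OpensMeasurableSpace X] {S : Set (ProbabilityMeasure X)}
    {P : ProbabilityMeasure X} (hP : P ∈ S) :
    P.toFiniteMeasure ∈ cchull S :=
  subset_closure (subset_convexHull _ _ (Set.mem_image_of_mem _ hP))

section

variable {X : Type*} [TopologicalSpace X] [CompactSpace X] [MeasurableSpace X]
  [OpensMeasurableSpace X]

lemma integrable_continuousMap (μ : Measure X) [IsFiniteMeasure μ] (f : C(X, ℝ)) :
    Integrable f μ :=
  (BoundedContinuousFunction.mkOfCompact f).integrable μ

lemma integral_sub_integral_eq (μ ν : Measure X) [IsFiniteMeasure μ] [IsFiniteMeasure ν]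
    (f : C(X, ℝ)) :
    ∫ x, f x ∂μ - ∫ x, f x ∂ν = ∫ x, f x ∂(μ - ν) - ∫ x, f x ∂(ν - μ) := by
  have h := congrArg (fun m : Measure X ↦ ∫ x, f x ∂m) (add_sub_eq_add_sub_measure μ ν)
  rw [integral_add_measure (integrable_continuousMap _ f) (integrable_continuousMap _ f),
    integral_add_measure (integrable_continuousMap _ f) (integrable_continuousMap _ f)] at h
  linarith

lemma integral_sub_integral_le (P Q : FiniteMeasure X) (f : C(X, ℝ)) :
    ∫ x, f x ∂(P : Measure X) - ∫ x, f x ∂(Q : Measure X) ≤ tvDist P Q * ‖f‖ := by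
  rw [integral_sub_integral_eq, tvDist_eq, add_mul]
  have h₁ := norm_integral_continuousMap_le (P.toMeasure - Q.toMeasure) f
  have h₂ := norm_integral_continuousMap_le (Q.toMeasure - P.toMeasure) f
  rw [Real.norm_eq_abs] at h₁ h₂
  linarith [le_abs_self (∫ x, f x ∂(P.toMeasure - Q.toMeasure)),
    neg_abs_le (∫ x, f x ∂(Q.toMeasure - P.toMeasure))]

/-- Integration against a finite measure, as an element of the weak* dual of `C(X, ℝ)`. -/
def integralWeakDual (P : FiniteMeasure X) : WeakDual ℝ C(X, ℝ) :=
  StrongDual.toWeakDual <| LinearMap.mkContinuous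
    { toFun := fun f ↦ ∫ x, f x ∂(P : Measure X)
      map_add' := fun f g ↦
        integral_add (integrable_continuousMap _ f) (integrable_continuousMap _ g)
      map_smul' := fun c f ↦ integral_const_mul c f }
    ((P : Measure X).real Set.univ) (norm_integral_continuousMap_le _)

lemma integralWeakDual_apply (P : FiniteMeasure X) (f : C(X, ℝ)) :
    integralWeakDual P f = ∫ x, f x ∂(P : Measure X) := rfl

lemma continuous_integralWeakDual :
    Continuous (integralWeakDual : FiniteMeasure X → WeakDual ℝ C(X, ℝ)) :=
  WeakDual.continuous_of_continuous_eval fun f ↦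
    FiniteMeasure.continuous_integral_continuousMap f

lemma integral_finiteMeasure_add_smul (P Q : FiniteMeasure X) (a b : ℝ≥0) (f : C(X, ℝ)) :
    ∫ x, f x ∂((a • P + b • Q : FiniteMeasure X) : Measure X) =
      a * ∫ x, f x ∂(P : Measure X) + b * ∫ x, f x ∂(Q : Measure X) := by
  rw [FiniteMeasure.toMeasure_add, FiniteMeasure.toMeasure_smul, FiniteMeasure.toMeasure_smul,
    integral_add_measure (integrable_continuousMap _ f) (integrable_continuousMap _ f),
    integral_smul_nnreal_measure, integral_smul_nnreal_measure]
  rfl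

lemma le_integral_of_mem_cchull {S : Set (ProbabilityMeasure X)} {f : C(X, ℝ)} {a : ℝ}
    (h : ∀ P ∈ S, a ≤ ∫ x, f x ∂(P : Measure X)) {P : FiniteMeasure X} (hP : P ∈ cchull S) :
    a ≤ ∫ x, f x ∂(P : Measure X) := by
  have hclosed : IsClosed {P : FiniteMeasure X | a ≤ ∫ x, f x ∂(P : Measure X)} :=
    isClosed_le continuous_const (FiniteMeasure.continuous_integral_continuousMap f)
  refine closure_minimal (convexHull_min ?_ ?_) hclosed hP
  · rintro _ ⟨P, hP, rfl⟩
    exact h P hP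
  · intro P hP Q hQ s t _ _ hst
    simp only [Set.mem_ofPred_eq] at hP hQ ⊢
    rw [integral_finiteMeasure_add_smul]
    have hst' : (s : ℝ) + t = 1 := by exact_mod_cast hst
    have h₁ := mul_le_mul_of_nonneg_left hP s.coe_nonneg
    have h₂ := mul_le_mul_of_nonneg_left hQ t.coe_nonneg
    have h₃ : (s : ℝ) * a + t * a = a := by rw [← add_mul, hst', one_mul]
    linarith

lemma convex_image_integralWeakDual {H : Set (FiniteMeasure X)} (hH : Convex ℝ≥0 H) :
    Convex ℝ (integralWeakDual '' H) := by
  rintro _ ⟨P, hP, rfl⟩ _ ⟨Q, hQ, rfl⟩ a b ha hb hab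
  lift a to ℝ≥0 using ha
  lift b to ℝ≥0 using hb
  refine ⟨a • P + b • Q, hH hP hQ zero_le zero_le (by exact_mod_cast hab), ?_⟩
  refine DFunLike.ext _ _ fun f ↦ ?_
  exact integral_finiteMeasure_add_smul P Q a b f

end

lemma exists_strongDual_norm_le_apply_eq {E : Type*} [NormedAddCommGroup E] [NormedSpace ℝ E]
    (x : E) {ε : ℝ} (hε : 0 ≤ ε) :
    ∃ L : StrongDual ℝ E, ‖L‖ ≤ ε ∧ L x = ε * ‖x‖ := by
  obtain ⟨L, hL, hLx⟩ := exists_dual_vector'' ℝ x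
  refine ⟨ε • L, ?_, by simp [hLx]⟩
  rw [norm_smul, Real.norm_of_nonneg hε]
  exact mul_le_of_le_one_right hε hL

section

variable {X : Type*} [MetricSpace X] [CompactSpace X] [MeasurableSpace X] [BorelSpace X]

lemma tvDist_le_of_forall_integral_sub_le (P Q : FiniteMeasure X) {ε : ℝ}
    (hε : 0 ≤ ε) (h : ∀ f : C(X, ℝ),
      ∫ x, f x ∂(P : Measure X) - ∫ x, f x ∂(Q : Measure X) ≤ ε * ‖f‖) :
    tvDist P Q ≤ ε := by
  classical
  set A := P.toMeasure - Q.toMeasure with hA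
  set B := Q.toMeasure - P.toMeasure with hB
  obtain ⟨S, hS, hAS, hBS⟩ : A.MutuallySingular B := Measure.mutually_singular_measure_sub
  let g : X → ℝ := S.piecewise (fun _ ↦ -1) (fun _ ↦ 1)
  have hgm : Measurable g := measurable_const.piecewise hS measurable_const
  have hg1 (x : X) : -1 ≤ g x ∧ g x ≤ 1 := by
    by_cases hx : x ∈ S <;> simp [g, hx]
  have hgi (μ : Measure X) [IsFiniteMeasure μ] : Integrable g μ :=
    .of_bound hgm.aestronglyMeasurable 1 (.of_forall fun x ↦ abs_le.2 (hg1 x))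
  have hgA : ∫ x, g x ∂A = A.real Set.univ := by
    have : g =ᵐ[A] fun _ ↦ 1 := by
      filter_upwards [measure_eq_zero_iff_ae_notMem.1 hAS] with x hx
      simp [g, hx]
    rw [integral_congr_ae this]; simp
  have hgB : ∫ x, g x ∂B = - B.real Set.univ := by
    have : g =ᵐ[B] fun _ ↦ -1 := by
      filter_upwards [measure_eq_zero_iff_ae_notMem.1 hBS] with x hx
      simp only [Set.mem_compl_iff, not_not] at hx
      simp [g, hx]
    rw [integral_congr_ae this]; simp
  refine le_of_forall_pos_le_add fun δ hδ ↦ ?_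
  obtain ⟨u, hu, hui⟩ := (hgi (A + B)).exists_boundedContinuous_integral_sub_le hδ
  let c : C(X, ℝ) := ⟨fun x ↦ max (-1) (min (u x) 1), by fun_prop⟩
  have hc1 : ‖c‖ ≤ 1 := (ContinuousMap.norm_le _ zero_le_one).2 fun x ↦
    abs_le.2 ⟨le_max_left _ _, max_le (by norm_num) (min_le_right _ _)⟩
  have hcu (x : X) : |g x - c x| ≤ ‖g x - u x‖ := by
    obtain ⟨h₁, h₂⟩ := hg1 x
    have hgx : g x = max (-1) (min (g x) 1) := by rw [min_eq_left h₂, max_eq_right h₁]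
    calc |g x - c x| = |max (-1) (min (g x) 1) - max (-1) (min (u x) 1)| := by rw [← hgx]; rfl
      _ ≤ |min (g x) 1 - min (u x) 1| := by
        rw [max_comm, max_comm (-1)]
        exact abs_sup_sub_sup_le_abs _ _ _
      _ ≤ |g x - u x| := abs_inf_sub_inf_le_abs _ _ _
  have hci (μ : Measure X) [IsFiniteMeasure μ] := integrable_continuousMap μ c
  have hdi (μ : Measure X) [IsFiniteMeasure μ] : Integrable (fun x ↦ |g x - c x|) μ :=
    ((hgi μ).sub (hci μ)).abs
  have hle : ∫ x, |g x - c x| ∂(A + B) ≤ δ :=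
    (integral_mono (hdi _) ((hgi _).sub hui).norm hcu).trans hu
  rw [integral_add_measure (hdi A) (hdi B)] at hle
  have h₁ := (le_abs_self _).trans (abs_integral_le_integral_abs (f := fun x ↦ g x - c x) (μ := A))
  have h₂ := (neg_le_abs _).trans (abs_integral_le_integral_abs (f := fun x ↦ g x - c x) (μ := B))
  rw [integral_sub (hgi _) (hci _)] at h₁ h₂
  have h₃ := h c
  rw [integral_sub_integral_eq, ← hA, ← hB] at h₃
  rw [tvDist_eq, ← hA, ← hB]
  have := mul_le_mul_of_nonneg_left hc1 hε
  linarith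

lemma isCompact_cchull (S : Set (ProbabilityMeasure X)) : IsCompact (cchull S) := by
  have hK : IsCompact (Set.range (ProbabilityMeasure.toFiniteMeasure (Ω := X))) :=
    isCompact_range ProbabilityMeasure.toFiniteMeasure_continuous
  refine hK.of_isClosed_subset isClosed_closure
    (closure_minimal (convexHull_min (Set.image_subset_range _ _) ?_) hK.isClosed)
  rw [ProbabilityMeasure.range_toFiniteMeasure]
  intro P hP Q hQ a b _ _ hab
  have hP' : P Set.univ = 1 := hP
  have hQ' : Q Set.univ = 1 := hQ
  change (a • P + b • Q) Set.univ = 1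
  simp [hP', hQ', hab]

lemma convex_image_cchull (S : Set (ProbabilityMeasure X)) :
    Convex ℝ (integralWeakDual '' cchull S) := by
  rw [cchull, image_closure_of_isCompact (isCompact_cchull S)
    continuous_integralWeakDual.continuousOn]
  exact (convex_image_integralWeakDual (convex_convexHull _ _)).closure

open scoped Pointwise in
lemma exists_lt_integral_sub_of_forall_lt_tvDist {S T : Set (ProbabilityMeasure X)}
    {ε : ℝ} (hε : 0 ≤ ε) (h : ∀ P ∈ cchull S, ∀ Q ∈ cchull T, ε < tvDist P Q) :
    ∃ f : C(X, ℝ), ∀ P ∈ cchull S, ∀ Q ∈ cchull T,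
      ε * ‖f‖ < ∫ x, f x ∂(P : Measure X) - ∫ x, f x ∂(Q : Measure X) := by
  let K : Set (WeakDual ℝ C(X, ℝ)) := WeakDual.toStrongDual ⁻¹' Metric.closedBall 0 ε
  let D : Set (WeakDual ℝ C(X, ℝ)) := integralWeakDual '' cchull S - integralWeakDual '' cchull T
  have hK : IsCompact K := WeakDual.isCompact_closedBall 0 ε
  have hKc : Convex ℝ K :=
    (convex_closedBall (0 : StrongDual ℝ C(X, ℝ)) ε).linear_preimage
      (WeakDual.toStrongDual (𝕜 := ℝ) (E := C(X, ℝ))).toLinearMap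
  have hD : IsCompact D := by
    rw [show D = _ from sub_eq_add_neg _ _]
    exact ((isCompact_cchull S).image continuous_integralWeakDual).add
      ((isCompact_cchull T).image continuous_integralWeakDual).neg
  have hDc : Convex ℝ D := (convex_image_cchull S).sub (convex_image_cchull T)
  have hdisj : Disjoint K D := by
    rw [Set.disjoint_left]
    rintro _ hL ⟨_, ⟨P, hP, rfl⟩, _, ⟨Q, hQ, rfl⟩, rfl⟩
    refine (h P hP Q hQ).not_ge (tvDist_le_of_forall_integral_sub_le P Q hε fun f ↦ ?_)
    have hn : ‖WeakDual.toStrongDual (integralWeakDual P - integralWeakDual Q)‖ ≤ ε :=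
      (mem_closedBall_zero_iff (E := StrongDual ℝ C(X, ℝ))).1 hL
    exact (le_abs_self _).trans (ContinuousLinearMap.le_of_opNorm_le _ hn f)
  have : LocallyConvexSpace ℝ (WeakDual ℝ C(X, ℝ)) :=
    (WeakDual.withSeminorms ℝ C(X, ℝ)).toLocallyConvexSpace
  obtain ⟨φ, u, v, hu, huv, hv⟩ :=
    geometric_hahn_banach_compact_closed hKc hK hDc hD.isClosed hdisj
  obtain ⟨f, hf⟩ := LinearMap.dualEmbedding_surjective (topDualPairing ℝ C(X, ℝ)) φ
  have hφ (L : WeakDual ℝ C(X, ℝ)) : φ L = L f := by rw [← hf]; rfl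
  obtain ⟨L, hL, hLf⟩ := exists_strongDual_norm_le_apply_eq f hε
  have h₁ := hu (StrongDual.toWeakDual L) (mem_closedBall_zero_iff.2 hL)
  rw [hφ, StrongDual.toWeakDual_apply, hLf] at h₁
  refine ⟨f, fun P hP Q hQ ↦ ?_⟩
  have h₂ := hv _ (Set.sub_mem_sub (Set.mem_image_of_mem _ hP) (Set.mem_image_of_mem _ hQ))
  rw [hφ] at h₂
  exact h₁.trans (huv.trans h₂)

lemma lt_integral_sub_of_mem_cchull {S T : Set (ProbabilityMeasure X)} (hS : IsCompact S)
    (hT : IsCompact T) (hSne : S.Nonempty) (hTne : T.Nonempty) {f : C(X, ℝ)} {ε : ℝ}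
    (h : ∀ P ∈ S, ∀ Q ∈ T, ε < ∫ x, f x ∂(P : Measure X) - ∫ x, f x ∂(Q : Measure X))
    {P Q : FiniteMeasure X} (hP : P ∈ cchull S) (hQ : Q ∈ cchull T) :
    ε < ∫ x, f x ∂(P : Measure X) - ∫ x, f x ∂(Q : Measure X) := by
  have hcont : Continuous fun P : ProbabilityMeasure X ↦ ∫ x, f x ∂(P : Measure X) :=
    (FiniteMeasure.continuous_integral_continuousMap f).comp
      ProbabilityMeasure.toFiniteMeasure_continuous
  obtain ⟨P₀, hP₀, hmin⟩ := hS.exists_isMinOn hSne hcont.continuousOn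
  obtain ⟨Q₀, hQ₀, hmax⟩ := hT.exists_isMaxOn hTne hcont.continuousOn
  have h₁ := le_integral_of_mem_cchull (fun P hP ↦ hmin hP) hP
  have h₂ : -∫ x, f x ∂(Q₀ : Measure X) ≤ ∫ x, (-f) x ∂(Q : Measure X) := by
    refine le_integral_of_mem_cchull (fun Q hQ ↦ ?_) hQ
    simpa [integral_neg] using hmax hQ
  simp only [ContinuousMap.neg_apply, integral_neg] at h₂
  linarith [h P₀ hP₀ Q₀ hQ₀]

end

theorem stmt3 {X : Type*} [MetricSpace X] [CompactSpace X] [MeasurableSpace X] [BorelSpace X]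
    (𝒮 𝒬 : Set (ProbabilityMeasure X)) (h𝒮 : IsCompact 𝒮) (h𝒬 : IsCompact 𝒬)
    (h𝒮ne : 𝒮.Nonempty) (h𝒬ne : 𝒬.Nonempty)
    (ε : ℝ) (hε : 0 < ε) :
    Xor'
      (∃ f : C(X, ℝ), ‖f‖ = 1 ∧ ∀ P ∈ 𝒮, ∀ Q ∈ 𝒬,
        ∫ x, f x ∂(P : Measure X) - ∫ x, f x ∂(Q : Measure X) > ε)
      (∃ P ∈ cchull 𝒮, ∃ Q ∈ cchull 𝒬, tvDist P Q ≤ ε) := by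
  change Xor _ _
  rw [xor_iff_or_and_not_and]
  constructor
  · rw [or_iff_not_imp_right]
    intro h
    push Not at h
    obtain ⟨f, hf⟩ := exists_lt_integral_sub_of_forall_lt_tvDist hε.le h
    have hf0 : f ≠ 0 := by
      rintro rfl
      obtain ⟨P, hP⟩ := h𝒮ne
      obtain ⟨Q, hQ⟩ := h𝒬ne
      simpa using hf _ (subset_cchull hP) _ (subset_cchull hQ)
    have hpos : 0 < ‖f‖ := norm_pos_iff.2 hf0
    refine ⟨‖f‖⁻¹ • f, norm_smul_inv_norm hf0, fun P hP Q hQ ↦ ?_⟩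
    have := hf _ (subset_cchull hP) _ (subset_cchull hQ)
    simp only [ContinuousMap.smul_apply, smul_eq_mul, integral_const_mul]
    rw [← mul_sub, gt_iff_lt, lt_inv_mul_iff₀ hpos, mul_comm]
    exact this
  · rintro ⟨⟨f, hf1, hf⟩, P, hP, Q, hQ, hPQ⟩
    have h₁ := lt_integral_sub_of_mem_cchull h𝒮 h𝒬 h𝒮ne h𝒬ne hf hP hQ
    have h₂ := integral_sub_integral_le P Q f
    rw [hf1, mul_one] at h₂
    linarith

end
end

section
/- Let X be a compact metric space, P a Borel probability measure on X, Q a nonempty weak*-compact subset of Δ(X), and ε ∈ [0,1]. There exist a Borel probability measure R on X and a Borel probability measure m on Q such that P(E) = (1 − ε)·Q_m(E) + ε·R(E) for all Borel E ⊆ X if, and only if, P and Q satisfy condition C*_ε: for all continuous f, g : X → ℝ, if ∫_X f dQ ≥ ∫_X g dQ for all Q ∈ Q, then ∫_X f dP ≥ ∫_X g dP − ε·[ω(f − g) − max over x ∈ X of (f(x) − g(x))], where ω(h) = sup over x₁, x₂ ∈ X of (h(x₁) − h(x₂)). -/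
open MeasureTheory
open scoped NNReal

noncomputable section

noncomputable instance {X : Type*} [MeasurableSpace X] [TopologicalSpace X] [OpensMeasurableSpace X] :
    MeasurableSpace (ProbabilityMeasure X) := borel _

/-- Oscillation of a continuous function: `ω(h) = sup_{x₁,x₂} (h x₁ - h x₂)`. -/
def osc {X : Type*} [TopologicalSpace X] (h : C(X, ℝ)) : ℝ :=
  ⨆ p : X × X, (h p.1 - h p.2)

/-- `Qm` is the barycenter of `m : Δ(𝒬)`: `Qm E = ∫_𝒬 Q(E) dm(Q)` for every Borel `E`. -/
def IsBarycenter {X : Type*} [MeasurableSpace X] [TopologicalSpace X] [OpensMeasurableSpace X]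
    (𝒬 : Set (ProbabilityMeasure X)) (m : Measure ↥𝒬) (Qm : ProbabilityMeasure X) : Prop :=
  ∀ E : Set X, MeasurableSet E →
    (Qm E : ℝ) = ∫ Q, ((Q : ProbabilityMeasure X) E : ℝ) ∂m

section Riesz

variable {Y : Type*} [TopologicalSpace Y] [CompactSpace Y]

theorem ContinuousMap.bddAbove_range_of_compactSpace (F : C(Y, ℝ)) : BddAbove (Set.range F) :=
  (isCompact_range F.continuous).bddAbove

variable [Nonempty Y]

theorem ContinuousMap.exists_isMax_of_compactSpace (F : C(Y, ℝ)) :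
    ∃ y, (∀ z, F z ≤ F y) ∧ ⨆ z, F z = F y := by
  obtain ⟨y, -, hy⟩ := isCompact_univ.exists_isMaxOn Set.univ_nonempty F.continuous.continuousOn
  have hy' : ∀ z, F z ≤ F y := fun z => hy (Set.mem_univ z)
  exact ⟨y, hy', le_antisymm (ciSup_le hy') (le_ciSup F.bddAbove_range_of_compactSpace y)⟩

/-- A linear functional on `C(Y, ℝ)` dominated by the supremum is integration against a
probability measure. -/
theorem exists_isProbabilityMeasure_integral_eq [T2Space Y] [MeasurableSpace Y] [BorelSpace Y]
    (Λ : C(Y, ℝ) →ₗ[ℝ] ℝ) (hΛ : ∀ F, Λ F ≤ ⨆ y, F y) :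
    ∃ μ : Measure Y, IsProbabilityMeasure μ ∧ ∀ F : C(Y, ℝ), ∫ y, F y ∂μ = Λ F := by
  have hpos : ∀ F : C(Y, ℝ), (∀ y, 0 ≤ F y) → 0 ≤ Λ F := by
    intro F hF
    have h := hΛ (-F)
    have : ⨆ y, (-F) y ≤ 0 := ciSup_le fun y => by simpa using hF y
    rw [map_neg] at h
    linarith
  let L : CompactlySupportedContinuousMap Y ℝ →ₗ[ℝ] ℝ :=
    { toFun := fun F => Λ F.toContinuousMap
      map_add' := fun F G => Λ.map_add F.toContinuousMap G.toContinuousMap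
      map_smul' := fun c F => Λ.map_smul c F.toContinuousMap }
  let L' := PositiveLinearMap.mk₀ L fun F hF => hpos _ (show ⇑(0 : C(Y, ℝ)) ≤ F from hF)
  have hint : ∀ F : C(Y, ℝ), ∫ y, F y ∂(RealRMK.rieszMeasure L') = Λ F := fun F =>
    RealRMK.integral_rieszMeasure L' (CompactlySupportedContinuousMap.continuousMapEquiv F)
  refine ⟨RealRMK.rieszMeasure L', ⟨?_⟩, hint⟩
  have h1 : Λ 1 = 1 := by
    have h := hΛ 1
    have h' := hΛ (-1)
    simp at h h'
    linarith
  have h := hint 1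
  simp only [ContinuousMap.one_apply, integral_const, smul_eq_mul, mul_one, h1] at h
  rwa [measureReal_def, ENNReal.toReal_eq_one_iff] at h

/-- If a linear functional `φ` on `V` satisfies `φ v ≤ sup (T v)` for a linear map
`T : V → C(Y, ℝ)`, then `φ` is represented through `T` by a probability measure on `Y`. -/
theorem exists_isProbabilityMeasure_integral_comp_eq [T2Space Y] [MeasurableSpace Y] [BorelSpace Y]
    {V : Type*} [AddCommGroup V] [Module ℝ V] (T : V →ₗ[ℝ] C(Y, ℝ)) (φ : V →ₗ[ℝ] ℝ)
    (hφ : ∀ v, φ v ≤ ⨆ y, T v y) :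
    ∃ μ : Measure Y, IsProbabilityMeasure μ ∧ ∀ v, ∫ y, T v y ∂μ = φ v := by
  have hker : φ ∈ T.ker.dualAnnihilator := by
    rw [Submodule.mem_dualAnnihilator]
    intro v hv
    rw [LinearMap.mem_ker] at hv
    have h := hφ v
    have h' := hφ (-v)
    simp [hv] at h h'
    linarith
  rw [← LinearMap.range_dualMap_eq_dualAnnihilator_ker] at hker
  obtain ⟨ψ, rfl⟩ := hker
  obtain ⟨Λ, hΛ, hle⟩ := exists_extension_of_le_sublinear
    (⟨T.range, ψ.domRestrict T.range⟩ : C(Y, ℝ) →ₗ.[ℝ] ℝ) (fun F => ⨆ y, F y)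
    (fun c hc F => (Real.mul_iSup_of_nonneg hc.le _).symm)
    (fun F G => ciSup_le fun y => add_le_add
      (le_ciSup F.bddAbove_range_of_compactSpace y) (le_ciSup G.bddAbove_range_of_compactSpace y))
    (by rintro ⟨_, v, rfl⟩; exact hφ v)
  obtain ⟨μ, hμ, hint⟩ := exists_isProbabilityMeasure_integral_eq Λ hle
  exact ⟨μ, hμ, fun v => (hint _).trans (hΛ ⟨T v, v, rfl⟩)⟩

end Riesz

theorem osc_sub_iSup {X : Type*} [TopologicalSpace X] [CompactSpace X] [Nonempty X] (h : C(X, ℝ)) :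
    osc h - ⨆ x, h x = ⨆ x, -h x := by
  obtain ⟨a, ha, ha'⟩ := h.exists_isMax_of_compactSpace
  obtain ⟨b, hb, hb'⟩ := (-h).exists_isMax_of_compactSpace
  simp only [ContinuousMap.neg_apply] at hb hb'
  have hle : ∀ p : X × X, h p.1 - h p.2 ≤ h a - h b := fun p => by
    linarith [ha p.1, hb p.2]
  have : osc h = h a - h b := le_antisymm (ciSup_le hle)
    (le_ciSup (f := fun p : X × X => h p.1 - h p.2) ⟨_, Set.forall_mem_range.2 hle⟩ (a, b))
  rw [this, ha', hb']
  ring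

section Kernel

variable {X : Type*} [MeasurableSpace X] [TopologicalSpace X]

instance [OpensMeasurableSpace X] : BorelSpace (ProbabilityMeasure X) := ⟨rfl⟩

theorem continuous_integral_probabilityMeasure [OpensMeasurableSpace X] [CompactSpace X]
    (h : C(X, ℝ)) : Continuous fun Q : ProbabilityMeasure X => ∫ x, h x ∂(Q : Measure X) :=
  continuous_iff_continuousAt.2 fun _ =>
    ProbabilityMeasure.tendsto_iff_forall_integral_tendsto.1 Filter.tendsto_id
      (BoundedContinuousFunction.mkOfCompact h)

theorem measurable_coe_probabilityMeasure [BorelSpace X] [HasOuterApproxClosed X] :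
    Measurable fun Q : ProbabilityMeasure X => (Q : Measure X) := by
  refine Measurable.measure_of_isPiSystem_of_isProbabilityMeasure
    (BorelSpace.measurable_eq (α := X)) isPiSystem_isOpen fun U hU => ?_
  refine LowerSemicontinuous.measurable fun Q => ?_
  exact lowerSemicontinuousAt_iff_le_liminf.2 <| ProbabilityMeasure.le_liminf_measure_open_of_tendsto Filter.tendsto_id hU

variable [BorelSpace X] [HasOuterApproxClosed X]

/-- The kernel sending an element of a set of probability measures to itself. -/
def probabilityMeasureKernel (𝒬 : Set (ProbabilityMeasure X)) : ProbabilityTheory.Kernel 𝒬 X where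
  toFun Q := (Q : ProbabilityMeasure X)
  measurable' := measurable_coe_probabilityMeasure.comp measurable_subtype_coe

instance (𝒬 : Set (ProbabilityMeasure X)) :
    ProbabilityTheory.IsMarkovKernel (probabilityMeasureKernel 𝒬) :=
  ⟨fun Q => (Q : ProbabilityMeasure X).prop⟩

theorem isBarycenter_iff (𝒬 : Set (ProbabilityMeasure X)) (m : Measure 𝒬) [IsProbabilityMeasure m]
    (Qm : ProbabilityMeasure X) :
    IsBarycenter 𝒬 m Qm ↔ (Qm : Measure X) = m.bind (probabilityMeasureKernel 𝒬) := by
  have key : ∀ E, MeasurableSet E → ∫ Q, ((Q : ProbabilityMeasure X) E : ℝ) ∂m =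
      (m.bind (probabilityMeasureKernel 𝒬)).real E := by
    intro E hE
    rw [measureReal_def, Measure.bind_apply hE (probabilityMeasureKernel 𝒬).aemeasurable]
    exact integral_toReal ((probabilityMeasureKernel 𝒬).measurable_coe hE).aemeasurable
      (.of_forall fun Q => measure_lt_top _ _)
  constructor
  · intro h
    refine Measure.ext fun E hE => ?_
    rw [← measureReal_eq_measureReal_iff, ← key E hE]
    exact h E hE
  · intro h E hE
    rw [key E hE, ← h]
    rfl

theorem integral_bind_probabilityMeasureKernel [CompactSpace X] (𝒬 : Set (ProbabilityMeasure X))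
    (m : Measure 𝒬) [IsProbabilityMeasure m] (h : C(X, ℝ)) :
    ∫ x, h x ∂(m.bind (probabilityMeasureKernel 𝒬)) =
      ∫ Q : 𝒬, ∫ x, h x ∂((Q : ProbabilityMeasure X) : Measure X) ∂m := by
  rw [Measure.comp_eq_comp_const_apply]
  exact ProbabilityTheory.Kernel.integral_comp
    (h.continuous.integrable_of_hasCompactSupport (.of_compactSpace _))

end Kernel

/-- The mixture identity on Borel sets is the same as the identity of integrals of continuous
functions. -/
theorem forall_eq_mixture_iff {X : Type*} [MeasurableSpace X] [TopologicalSpace X] [BorelSpace X]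
    [HasOuterApproxClosed X] [CompactSpace X] (μ ν ν' : Measure X) [IsProbabilityMeasure μ]
    [IsProbabilityMeasure ν] [IsProbabilityMeasure ν'] {ε : ℝ} (hε0 : 0 ≤ ε) (hε1 : ε ≤ 1) :
    (∀ E, MeasurableSet E → μ.real E = (1 - ε) * ν.real E + ε * ν'.real E) ↔
      ∀ h : C(X, ℝ), ∫ x, h x ∂μ = (1 - ε) * ∫ x, h x ∂ν + ε * ∫ x, h x ∂ν' := by
  let S : Measure X := (1 - ε).toNNReal • ν + ε.toNNReal • ν'
  have hint : ∀ (h : C(X, ℝ)) (κ : Measure X) [IsFiniteMeasure κ], Integrable h κ := fun h κ _ =>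
    h.continuous.integrable_of_hasCompactSupport (.of_compactSpace _)
  have hS : ∀ E, S.real E = (1 - ε) * ν.real E + ε * ν'.real E := fun E => by
    rw [measureReal_add_apply, measureReal_nnreal_smul_apply, measureReal_nnreal_smul_apply,
      Real.coe_toNNReal _ (sub_nonneg.2 hε1), Real.coe_toNNReal _ hε0]
  have hSint : ∀ h : C(X, ℝ),
      ∫ x, h x ∂S = (1 - ε) * ∫ x, h x ∂ν + ε * ∫ x, h x ∂ν' := fun h => by
    rw [integral_add_measure (hint h _) (hint h _), integral_smul_nnreal_measure,
      integral_smul_nnreal_measure, NNReal.smul_def, NNReal.smul_def,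
      Real.coe_toNNReal _ (sub_nonneg.2 hε1), Real.coe_toNNReal _ hε0, smul_eq_mul, smul_eq_mul]
  simp only [← hS, ← hSint]
  constructor
  · intro h
    rw [show μ = S from Measure.ext fun E hE => (measureReal_eq_measureReal_iff).1 (h E hE)]
    exact fun _ => rfl
  · intro h
    rw [ext_of_forall_integral_eq_of_IsFiniteMeasure (μ := μ) (ν := S) fun f => h f.toContinuousMap]
    exact fun _ _ => rfl

theorem stmt8 {X : Type*} [MetricSpace X] [CompactSpace X] [MeasurableSpace X] [BorelSpace X]
    (P : ProbabilityMeasure X)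
    (𝒬 : Set (ProbabilityMeasure X)) (h𝒬 : IsCompact 𝒬) (h𝒬ne : 𝒬.Nonempty)
    (ε : ℝ) (hε0 : 0 ≤ ε) (hε1 : ε ≤ 1) :
    (∃ (R : ProbabilityMeasure X) (m : Measure ↥𝒬) (_ : IsProbabilityMeasure m)
        (Qm : ProbabilityMeasure X), IsBarycenter 𝒬 m Qm ∧
          ∀ E : Set X, MeasurableSet E →
            (P E : ℝ) = (1 - ε) * (Qm E : ℝ) + ε * (R E : ℝ)) ↔
      (∀ f g : C(X, ℝ),
        (∀ Q ∈ 𝒬, ∫ x, g x ∂(Q : Measure X) ≤ ∫ x, f x ∂(Q : Measure X)) →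
          ∫ x, f x ∂(P : Measure X) ≥
            ∫ x, g x ∂(P : Measure X) - ε * (osc (f - g) - ⨆ x : X, (f x - g x))) := by
  have : Nonempty X := P.nonempty
  have : CompactSpace 𝒬 := isCompact_iff_compactSpace.1 h𝒬
  have : Nonempty 𝒬 := h𝒬ne.to_subtype
  have hint : ∀ (h : C(X, ℝ)) (μ : Measure X) [IsFiniteMeasure μ], Integrable h μ := fun h μ _ =>
    h.continuous.integrable_of_hasCompactSupport (.of_compactSpace _)
  have hosc : ∀ f g : C(X, ℝ), osc (f - g) - ⨆ x, (f x - g x) = ⨆ x, (g x - f x) := fun f g => by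
    simpa using osc_sub_iSup (f - g)
  simp only [hosc]
  constructor
  · rintro ⟨R, m, hm, Qm, hQm, hP⟩ f g hfg
    have hmix := (forall_eq_mixture_iff P Qm R hε0 hε1).1 hP (g - f)
    rw [isBarycenter_iff] at hQm
    have hsub : ∀ μ : Measure X, [IsFiniteMeasure μ] →
        ∫ x, (g - f) x ∂μ = ∫ x, g x ∂μ - ∫ x, f x ∂μ := fun μ _ =>
      integral_sub (hint g μ) (hint f μ)
    have hQ : ∫ x, (g - f) x ∂(Qm : Measure X) ≤ 0 := by
      rw [hQm, integral_bind_probabilityMeasureKernel]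
      refine integral_nonpos fun Q => ?_
      rw [hsub]
      exact sub_nonpos.2 (hfg Q Q.2)
    have hR : ∫ x, (g - f) x ∂(R : Measure X) ≤ ⨆ x, (g x - f x) := by
      refine (integral_mono (hint _ _) (integrable_const _) fun x =>
        le_ciSup (g - f).bddAbove_range_of_compactSpace x).trans_eq ?_
      rw [integral_const, probReal_univ, one_smul]
      rfl
    rw [hsub] at hmix
    nlinarith [mul_nonneg (sub_nonneg.2 hε1) (neg_nonneg.2 hQ), mul_le_mul_of_nonneg_left hR hε0]
  · intro hC
    borelize (𝒬 × X)
    let I : C(X, ℝ) → C(𝒬, ℝ) := fun h =>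
      ⟨fun Q => ∫ x, h x ∂((Q : ProbabilityMeasure X) : Measure X),
        (continuous_integral_probabilityMeasure h).comp continuous_subtype_val⟩
    let T : C(X, ℝ) →ₗ[ℝ] C(𝒬 × X, ℝ) :=
      { toFun := fun h => (1 - ε) • (I h).comp .fst + ε • h.comp .snd
        map_add' := fun h k => by
          ext y
          simp [I, integral_add (hint h _) (hint k _)]
          ring
        map_smul' := fun c h => by
          ext y
          simp [I, integral_const_mul]
          ring }
    let φ : C(X, ℝ) →ₗ[ℝ] ℝ :=
      { toFun := fun h => ∫ x, h x ∂(P : Measure X)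
        map_add' := fun h k => integral_add (hint h _) (hint k _)
        map_smul' := fun c h => integral_const_mul c _ }
    obtain ⟨μ, hμ, hμT⟩ := exists_isProbabilityMeasure_integral_comp_eq T φ fun h => by
      obtain ⟨Q, hQ, -⟩ := (I h).exists_isMax_of_compactSpace
      obtain ⟨x, -, hx⟩ := h.exists_isMax_of_compactSpace
      have hle := hC (.const X (I h Q)) h fun Q' hQ' => by
        simpa using! hQ ⟨Q', hQ'⟩
      have hsup : ⨆ z, (h z - I h Q) = h x - I h Q := by
        rw [← hx, ciSup_sub h.bddAbove_range_of_compactSpace]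
      simp only [ContinuousMap.const_apply, integral_const, probReal_univ, one_smul, hsup] at hle
      have hT : T h (Q, x) ≤ ⨆ y, T h y := le_ciSup (T h).bddAbove_range_of_compactSpace (Q, x)
      refine le_trans ?_ hT
      change ∫ x, h x ∂(P : Measure X) ≤ (1 - ε) * I h Q + ε * h x
      linarith
    have hfst : Measurable (Prod.fst : 𝒬 × X → 𝒬) := continuous_fst.measurable
    have hsnd : Measurable (Prod.snd : 𝒬 × X → X) := continuous_snd.measurable
    let m := μ.map Prod.fst
    have hm : IsProbabilityMeasure m := Measure.isProbabilityMeasure_map hfst.aemeasurable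
    let R : ProbabilityMeasure X :=
      ⟨μ.map Prod.snd, Measure.isProbabilityMeasure_map hsnd.aemeasurable⟩
    let Qm : ProbabilityMeasure X := ⟨m.bind (probabilityMeasureKernel 𝒬), inferInstance⟩
    refine ⟨R, m, hm, Qm, (isBarycenter_iff 𝒬 m Qm).2 rfl,
      (forall_eq_mixture_iff (P : Measure X) Qm R hε0 hε1).2 fun h => ?_⟩
    have hQm : ∫ x, h x ∂(Qm : Measure X) = ∫ y, I h y.1 ∂μ :=
      (integral_bind_probabilityMeasureKernel 𝒬 m h).trans
        (integral_map hfst.aemeasurable (I h).continuous.aestronglyMeasurable)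
    have hR : ∫ x, h x ∂(R : Measure X) = ∫ y, h y.2 ∂μ :=
      integral_map hsnd.aemeasurable h.continuous.aestronglyMeasurable
    have hintμ : ∀ F : C(𝒬 × X, ℝ), Integrable F μ := fun F =>
      F.continuous.integrable_of_hasCompactSupport (.of_compactSpace _)
    rw [hQm, hR, ← integral_const_mul, ← integral_const_mul]
    exact (hμT h).symm.trans (integral_add (hintμ ((1 - ε) • (I h).comp .fst))
      (hintμ (ε • h.comp .snd)))

end
end

section
/- Let Y be a finite set with N_Y elements, D the family of all nonempty subsets of Y, X = {(y, B) : B ∈ D, y ∈ B}, L the set of all strict linear orders on Y, and for ≻ ∈ L let a_≻(y, B) = 1 if y is the ≻-maximal element of B and 0 otherwise. Let ε ∈ [0,1] and let P₀ be a stochastic choice function. Then P₀ satisfies ε-ARSP* (for every function t : X → ℕ, Σ_{(y,B) ∈ X} P₀(y, B)·t(y, B) ≤ (1 − ε)·max_{≻ ∈ L} Σ_{(y,B) ∈ X} a_≻(y, B)·t(y, B) + (2^{N_Y} − 1)·ε·(max t)) if, and only if, there exist a probability distribution π on L and a stochastic choice function R₀ such that P₀(y, B) = (1 − ε)·Σ_{≻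 ∈ L : a_≻(y,B) = 1} π(≻) + ε·R₀(y, B) for all (y, B) ∈ X. -/
noncomputable section

/-- The type of strict linear orders (irreflexive, transitive, total relations) on `Y`. -/
abbrev SLO (Y : Type*) := {r : Y → Y → Prop // IsStrictTotalOrder Y r}

noncomputable instance {Y : Type*} [Finite Y] : Fintype (SLO Y) := Fintype.ofFinite _

instance {Y : Type*} : Nonempty (SLO Y) := ⟨⟨WellOrderingRel, inferInstance⟩⟩

open Classical in
/-- `a_≻(y,B) = 1` if no `y' ∈ B` satisfies `y' ≻ y`, and `0` otherwise. -/
def aFn {Y : Type*} (r : Y → Y → Prop) (y : Y) (B : Finset Y) : ℝ :=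
  if ∀ y' ∈ B, ¬ r y' y then 1 else 0

/-- The set `X` of pairs `(y, B)` with `B` a nonempty subset of `Y` and `y ∈ B`. -/
def allPairs (Y : Type*) [Fintype Y] [DecidableEq Y] : Finset (Y × Finset Y) :=
  Finset.univ.filter fun p => p.1 ∈ p.2

theorem allPairs_nonempty {Y : Type*} [Fintype Y] [DecidableEq Y] [Nonempty Y] :
    (allPairs Y).Nonempty := by
  obtain ⟨y⟩ := ‹Nonempty Y›
  exact ⟨(y, {y}), by simp [allPairs]⟩

/-- Maximum value of `t` over the pairs `(y, B)` with `y ∈ B`. -/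
def maxT {Y : Type*} [Fintype Y] [DecidableEq Y] [Nonempty Y] (t : Y → Finset Y → ℕ) : ℕ :=
  (allPairs Y).sup' allPairs_nonempty fun p => t p.1 p.2

/-- Minimum value of `t` over the pairs `(y, B)` with `y ∈ B`. -/
def minT {Y : Type*} [Fintype Y] [DecidableEq Y] [Nonempty Y] (t : Y → Finset Y → ℕ) : ℕ :=
  (allPairs Y).inf' allPairs_nonempty fun p => t p.1 p.2

/-- A stochastic choice function on a finite set `Y`. -/
def IsSCF {Y : Type*} [Fintype Y] [DecidableEq Y] (P₀ : Y → Finset Y → ℝ) : Prop :=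
  ∀ B : Finset Y, B.Nonempty → (∀ y ∈ B, 0 ≤ P₀ y B) ∧ (∑ y ∈ B, P₀ y B) = 1

open Finset in
theorem sum_allPairs {Y : Type*} [Fintype Y] [DecidableEq Y] (g : Y × Finset Y → ℝ) :
    ∑ p ∈ allPairs Y, g p =
      ∑ B ∈ univ.filter (fun B : Finset Y => B.Nonempty), ∑ y ∈ B, g (y, B) := by
  rw [allPairs, sum_filter, Fintype.sum_prod_type_right, sum_filter]
  refine sum_congr rfl fun B _ => ?_
  dsimp only
  split_ifs with h
  · simp
  · rw [not_nonempty_iff_eq_empty.1 h]; simp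

theorem card_nonempty_menus (Y : Type*) [Fintype Y] [DecidableEq Y] :
    (((Finset.univ.filter fun B : Finset Y => B.Nonempty).card : ℕ) : ℝ) =
      2 ^ Fintype.card Y - 1 := by
  have h : (Finset.univ.filter fun B : Finset Y => B.Nonempty) = Finset.univ.erase ∅ := by
    ext B; simp [Finset.nonempty_iff_ne_empty]
  rw [h, Finset.card_erase_of_mem (Finset.mem_univ _), Finset.card_univ, Fintype.card_finset,
    Nat.cast_sub Nat.one_le_two_pow]
  simp

/-- Pairing a stochastic choice function with a function of the menu alone. -/
theorem IsSCF.sum_mul_menu {Y : Type*} [Fintype Y] [DecidableEq Y] {Q : Y → Finset Y → ℝ}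
    (hQ : IsSCF Q) (c : Finset Y → ℝ) :
    ∑ p ∈ allPairs Y, Q p.1 p.2 * c p.2 =
      ∑ B ∈ Finset.univ.filter (fun B : Finset Y => B.Nonempty), c B := by
  rw [sum_allPairs]
  refine Finset.sum_congr rfl fun B hB => ?_
  dsimp only
  rw [← Finset.sum_mul, (hQ B (Finset.mem_filter.1 hB).2).2, one_mul]

theorem IsSCF.sum_mul_const {Y : Type*} [Fintype Y] [DecidableEq Y] {Q : Y → Finset Y → ℝ}
    (hQ : IsSCF Q) (c : ℝ) :
    ∑ p ∈ allPairs Y, Q p.1 p.2 * c = (2 ^ Fintype.card Y - 1) * c := by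
  rw [hQ.sum_mul_menu fun _ => c, Finset.sum_const, nsmul_eq_mul, card_nonempty_menus]

theorem IsSCF.nonneg {Y : Type*} [Fintype Y] [DecidableEq Y] {Q : Y → Finset Y → ℝ}
    (hQ : IsSCF Q) {p : Y × Finset Y} (hp : p ∈ allPairs Y) : 0 ≤ Q p.1 p.2 := by
  have hp : p.1 ∈ p.2 := by simpa [allPairs] using hp
  exact (hQ p.2 ⟨_, hp⟩).1 _ hp

theorem isSCF_aFn {Y : Type*} [Fintype Y] [DecidableEq Y] (r : SLO Y) : IsSCF (aFn r.1) := by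
  intro B hB
  refine ⟨fun y _ => by unfold aFn; split_ifs <;> norm_num, ?_⟩
  have := r.2
  obtain ⟨m, hm, hmin⟩ :=
    (Finite.wellFounded_of_trans_of_irrefl r.1).has_min (B : Set Y) hB
  rw [Finset.sum_eq_single_of_mem m hm]
  · exact if_pos hmin
  · intro y hy hne
    refine if_neg fun h => ?_
    rcases trichotomous_of r.1 m y with h1 | h1 | h1
    · exact h m hm h1
    · exact hne h1.symm
    · exact hmin y hy h1

/-- The stochastic choice functions with values in `[0, 1]`, indexed by pairs. -/
def scfSet (Y : Type*) [Fintype Y] [DecidableEq Y] : Set (Y × Finset Y → ℝ) :=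
  Set.Icc 0 1 ∩ {R | ∀ B : Finset Y, B.Nonempty → ∑ y ∈ B, R (y, B) = 1}

theorem isCompact_scfSet (Y : Type*) [Fintype Y] [DecidableEq Y] : IsCompact (scfSet Y) := by
  refine isCompact_Icc.inter_right ?_
  simp only [Set.ofPred_forall]
  exact isClosed_iInter fun B => isClosed_iInter fun _ =>
    isClosed_eq (by fun_prop) continuous_const

theorem convex_scfSet (Y : Type*) [Fintype Y] [DecidableEq Y] : Convex ℝ (scfSet Y) := by
  refine (convex_Icc _ _).inter ?_
  intro R hR S hS a b _ _ hab B hB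
  simp [Finset.sum_add_distrib, ← Finset.mul_sum, hR B hB, hS B hB, hab]

/-- The choice probabilities, on pairs `(y, B)` with `y ∈ B`, of the mixture of a random
preference `π` and of `R`. -/
def mixture {Y : Type*} [Fintype Y] [DecidableEq Y] (ε : ℝ) :
    ((SLO Y → ℝ) × (Y × Finset Y → ℝ)) →ₗ[ℝ] (Y × Finset Y → ℝ) where
  toFun q p := if p ∈ allPairs Y then
    (1 - ε) * (∑ r : SLO Y, q.1 r * aFn r.1 p.1 p.2) + ε * q.2 p else 0
  map_add' q q' := by
    ext p
    by_cases hp : p ∈ allPairs Y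
    · simp only [hp, if_true, Prod.fst_add, Prod.snd_add, Pi.add_apply, add_mul,
        Finset.sum_add_distrib]
      ring
    · simp [hp]
  map_smul' c q := by
    ext p
    by_cases hp : p ∈ allPairs Y
    · simp only [hp, if_true, Prod.smul_fst, Prod.smul_snd, Pi.smul_apply, smul_eq_mul, mul_assoc,
        ← Finset.mul_sum, RingHom.id_apply]
      ring
    · simp [hp]

theorem mixture_apply {Y : Type*} [Fintype Y] [DecidableEq Y] (ε : ℝ)
    (q : (SLO Y → ℝ) × (Y × Finset Y → ℝ)) {p : Y × Finset Y} (hp : p ∈ allPairs Y) :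
    mixture ε q p = (1 - ε) * (∑ r : SLO Y, q.1 r * aFn r.1 p.1 p.2) + ε * q.2 p :=
  if_pos hp

theorem sum_mul_le_of_mixture {Y : Type*} [Fintype Y] [DecidableEq Y] [Nonempty Y]
    {P₀ R₀ : Y → Finset Y → ℝ} {ε : ℝ} (hε0 : 0 ≤ ε) (hε1 : ε ≤ 1) {π : SLO Y → ℝ}
    (hπ0 : ∀ r, 0 ≤ π r) (hπ1 : ∑ r : SLO Y, π r = 1) (hR : IsSCF R₀)
    (hP : ∀ p ∈ allPairs Y, P₀ p.1 p.2 =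
      (1 - ε) * (∑ r : SLO Y, π r * aFn r.1 p.1 p.2) + ε * R₀ p.1 p.2)
    (t : Y → Finset Y → ℕ) :
    (∑ p ∈ allPairs Y, P₀ p.1 p.2 * t p.1 p.2) ≤
      (1 - ε) * (⨆ r : SLO Y, ∑ p ∈ allPairs Y, aFn r.1 p.1 p.2 * t p.1 p.2)
        + (2 ^ Fintype.card Y - 1) * ε * (maxT t : ℝ) := by
  set V : SLO Y → ℝ := fun r => ∑ p ∈ allPairs Y, aFn r.1 p.1 p.2 * t p.1 p.2 with hV
  have h1 : ∑ p ∈ allPairs Y, P₀ p.1 p.2 * t p.1 p.2 =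
      (1 - ε) * (∑ r, π r * V r) + ε * ∑ p ∈ allPairs Y, R₀ p.1 p.2 * t p.1 p.2 := by
    simp only [hV, Finset.mul_sum]
    rw [Finset.sum_comm, ← Finset.sum_add_distrib]
    refine Finset.sum_congr rfl fun p hp => ?_
    rw [hP p hp, Finset.mul_sum, add_mul, Finset.sum_mul]
    congr 1
    · exact Finset.sum_congr rfl fun r _ => by ring
    · ring
  have h2 : ∑ r, π r * V r ≤ ⨆ r, V r := by
    calc ∑ r, π r * V r ≤ ∑ r, π r * ⨆ r, V r := Finset.sum_le_sum fun r _ =>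
          mul_le_mul_of_nonneg_left (le_ciSup (Set.finite_range V).bddAbove r) (hπ0 r)
      _ = ⨆ r, V r := by rw [← Finset.sum_mul, hπ1, one_mul]
  have h3 : ∑ p ∈ allPairs Y, R₀ p.1 p.2 * t p.1 p.2 ≤ (2 ^ Fintype.card Y - 1) * maxT t := by
    rw [← hR.sum_mul_const]
    refine Finset.sum_le_sum fun p hp => mul_le_mul_of_nonneg_left ?_ (hR.nonneg hp)
    exact_mod_cast Finset.le_sup' (fun p : Y × Finset Y => t p.1 p.2) hp
  rw [h1]
  nlinarith [mul_le_mul_of_nonneg_left h2 (sub_nonneg.2 hε1), mul_le_mul_of_nonneg_left h3 hε0]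

/-- The inequality for natural-valued functions extends, in a weak form, to nonnegative reals. -/
theorem exists_order_sum_mul_le {Y : Type*} [Fintype Y] [DecidableEq Y] [Nonempty Y]
    {P₀ : Y → Finset Y → ℝ} (hSCF : IsSCF P₀) {ε : ℝ} (hε0 : 0 ≤ ε) (hε1 : ε ≤ 1)
    (h : ∀ t : Y → Finset Y → ℕ,
      (∑ p ∈ allPairs Y, P₀ p.1 p.2 * t p.1 p.2) ≤
        (1 - ε) * (⨆ r : SLO Y, ∑ p ∈ allPairs Y, aFn r.1 p.1 p.2 * t p.1 p.2)
          + (2 ^ Fintype.card Y - 1) * ε * (maxT t : ℝ))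
    (s : Y × Finset Y → ℝ) (M : ℝ) (hs0 : ∀ p ∈ allPairs Y, 0 ≤ s p)
    (hsM : ∀ p ∈ allPairs Y, s p ≤ M) :
    ∃ r : SLO Y, ∑ p ∈ allPairs Y, P₀ p.1 p.2 * s p ≤
      (1 - ε) * (∑ p ∈ allPairs Y, aFn r.1 p.1 p.2 * s p)
        + (2 ^ Fintype.card Y - 1) * ε * M := by
  set C : ℝ := 2 ^ Fintype.card Y - 1 with hC
  have hC0 : 0 ≤ C := sub_nonneg.2 (one_le_pow₀ one_le_two)
  obtain ⟨r, hr⟩ := Finite.exists_max fun r : SLO Y =>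
    ∑ p ∈ allPairs Y, aFn r.1 p.1 p.2 * s p
  refine ⟨r, le_of_forall_pos_sub_le fun δ hδ => ?_⟩
  obtain ⟨n, hn⟩ := exists_nat_gt (C / δ)
  have hn' : C < n * δ := (div_lt_iff₀ hδ).1 hn
  set t : Y → Finset Y → ℕ := fun y B => ⌊n * s (y, B)⌋₊
  have ht1 : ∀ p ∈ allPairs Y, (t p.1 p.2 : ℝ) ≤ n * s p := fun p hp =>
    Nat.floor_le (mul_nonneg n.cast_nonneg (hs0 p hp))
  have ht2 : ∀ p ∈ allPairs Y, n * s p - 1 ≤ (t p.1 p.2 : ℝ) := fun p _ =>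
    (Nat.sub_one_lt_floor _).le
  have hlow : n * (∑ p ∈ allPairs Y, P₀ p.1 p.2 * s p) - C ≤
      ∑ p ∈ allPairs Y, P₀ p.1 p.2 * t p.1 p.2 := by
    have h1 := hSCF.sum_mul_const 1
    rw [← hC, mul_one] at h1
    rw [← h1, Finset.mul_sum, ← Finset.sum_sub_distrib]
    refine Finset.sum_le_sum fun p hp => ?_
    nlinarith [mul_le_mul_of_nonneg_left (ht2 p hp) (hSCF.nonneg hp)]
  have hsup : (⨆ r : SLO Y, ∑ p ∈ allPairs Y, aFn r.1 p.1 p.2 * t p.1 p.2) ≤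
      n * ∑ p ∈ allPairs Y, aFn r.1 p.1 p.2 * s p := by
    refine ciSup_le fun r' => ?_
    refine le_trans ?_ (mul_le_mul_of_nonneg_left (hr r') n.cast_nonneg)
    rw [Finset.mul_sum]
    refine Finset.sum_le_sum fun p hp => ?_
    nlinarith [mul_le_mul_of_nonneg_left (ht1 p hp) ((isSCF_aFn r').nonneg hp)]
  have hmax : (maxT t : ℝ) ≤ n * M := by
    obtain ⟨p, hp, hpe⟩ := Finset.exists_mem_eq_sup' (allPairs_nonempty (Y := Y))
      fun p => t p.1 p.2
    rw [maxT, hpe]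
    exact (ht1 p hp).trans (mul_le_mul_of_nonneg_left (hsM p hp) n.cast_nonneg)
  have hn0 : (0 : ℝ) < n := lt_of_le_of_lt (div_nonneg hC0 hδ.le) hn
  have h1 := mul_le_mul_of_nonneg_left hsup (sub_nonneg.2 hε1)
  have h2 := mul_le_mul_of_nonneg_left hmax (mul_nonneg hC0 hε0)
  have h3 := h t
  refine le_of_mul_le_mul_left ?_ hn0
  linarith

theorem exists_mixture {Y : Type*} [Fintype Y] [DecidableEq Y] [Nonempty Y]
    {P₀ : Y → Finset Y → ℝ} (hSCF : IsSCF P₀) {ε : ℝ} (hε0 : 0 ≤ ε) (hε1 : ε ≤ 1)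
    (h : ∀ t : Y → Finset Y → ℕ,
      (∑ p ∈ allPairs Y, P₀ p.1 p.2 * t p.1 p.2) ≤
        (1 - ε) * (⨆ r : SLO Y, ∑ p ∈ allPairs Y, aFn r.1 p.1 p.2 * t p.1 p.2)
          + (2 ^ Fintype.card Y - 1) * ε * (maxT t : ℝ)) :
    (fun p => if p ∈ allPairs Y then P₀ p.1 p.2 else 0) ∈
      mixture ε '' (stdSimplex ℝ (SLO Y) ×ˢ scfSet Y) := by
  classical
  by_contra hP
  have hK : IsCompact (mixture ε '' (stdSimplex ℝ (SLO Y) ×ˢ scfSet Y)) :=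
    ((isCompact_stdSimplex ℝ _).prod (isCompact_scfSet Y)).image
      (LinearMap.continuous_of_finiteDimensional _)
  have hKc : Convex ℝ (mixture ε '' (stdSimplex ℝ (SLO Y) ×ˢ scfSet Y)) :=
    ((convex_stdSimplex ℝ _).prod (convex_scfSet Y)).linear_image _
  obtain ⟨f, u, hfK, hfP⟩ := geometric_hahn_banach_closed_point hKc hK.isClosed hP
  set t : Y × Finset Y → ℝ := fun p => f (Pi.single p 1) with ht
  have hf : ∀ x : Y × Finset Y → ℝ, (∀ p ∉ allPairs Y, x p = 0) →
      f x = ∑ p ∈ allPairs Y, x p * t p := by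
    intro x hx
    have hfx : f x = ∑ p, x p * t p := by
      conv_lhs => rw [pi_eq_sum_univ' x]
      simp only [map_sum, map_smul, smul_eq_mul, ht]
    rw [hfx]
    exact (Finset.sum_subset (Finset.subset_univ _) fun p _ hp => by rw [hx p hp, zero_mul]).symm
  have hmax : ∀ B : Finset Y, ∃ c, B.Nonempty → c ∈ B ∧ ∀ y ∈ B, t (y, B) ≤ t (c, B) := by
    intro B
    by_cases hB : B.Nonempty
    · obtain ⟨c, hc⟩ := B.exists_max_image (fun y => t (y, B)) hB
      exact ⟨c, fun _ => hc⟩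
    · exact ⟨Classical.arbitrary Y, fun h => absurd h hB⟩
  choose c hc using hmax
  obtain ⟨b, hb⟩ := (Set.finite_range fun p : Y × Finset Y => t (c p.2, p.2) - t p).bddAbove
  have hb' : ∀ p, t (c p.2, p.2) - t p ≤ b := fun p => hb ⟨p, rfl⟩
  set m : Finset Y → ℝ := fun B => t (c B, B) with hm
  obtain ⟨r, hr⟩ := exists_order_sum_mul_le hSCF hε0 hε1 h
    (fun p => t p + (b - m p.2)) b (fun p _ => by linarith [hb' p]) fun p hp => by
      have hp : p.1 ∈ p.2 := by simpa [allPairs] using hp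
      linarith [(hc p.2 ⟨_, hp⟩).2 p.1 hp]
  set R : Y → Finset Y → ℝ := fun y B => if y = c B then 1 else 0 with hRdef
  have hR : IsSCF R := fun B hB =>
    ⟨fun y _ => by simp only [hRdef]; split_ifs <;> norm_num, by simp [hRdef, (hc B hB).1]⟩
  have hRt : ∑ p ∈ allPairs Y, R p.1 p.2 * t p = ∑ p ∈ allPairs Y, R p.1 p.2 * m p.2 := by
    refine Finset.sum_congr rfl fun p _ => ?_
    by_cases hp : p.1 = c p.2
    · simp only [hm, ← hp]
    · simp [hRdef, hp]
  have hRmem : (fun p : Y × Finset Y => R p.1 p.2) ∈ scfSet Y := by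
    refine ⟨⟨fun p => ?_, fun p => ?_⟩, fun B hB => (hR B hB).2⟩ <;>
      · simp only [hRdef]; split_ifs <;> simp
  have hk := hfK _ ⟨(Pi.single r 1, fun p => R p.1 p.2),
    ⟨single_mem_stdSimplex ℝ r, hRmem⟩, rfl⟩
  have hk2 : f (mixture ε (Pi.single r 1, fun p => R p.1 p.2)) =
      (1 - ε) * (∑ p ∈ allPairs Y, aFn r.1 p.1 p.2 * t p)
        + ε * ∑ p ∈ allPairs Y, R p.1 p.2 * t p := by
    rw [hf (mixture ε _) fun p hp => if_neg hp, Finset.mul_sum, Finset.mul_sum, ← Finset.sum_add_distrib]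
    refine Finset.sum_congr rfl fun p hp => ?_
    rw [mixture_apply _ _ hp]
    simp [Pi.single_apply]
    ring
  have hP2 : f (fun p => if p ∈ allPairs Y then P₀ p.1 p.2 else 0) =
      ∑ p ∈ allPairs Y, P₀ p.1 p.2 * t p := by
    rw [hf _ fun p hp => if_neg hp]
    exact Finset.sum_congr rfl fun p hp => by rw [if_pos hp]
  simp only [mul_add, Finset.sum_add_distrib] at hr
  rw [hSCF.sum_mul_menu fun B => b - m B, (isSCF_aFn r).sum_mul_menu fun B => b - m B,
    Finset.sum_sub_distrib, Finset.sum_const, nsmul_eq_mul, card_nonempty_menus] at hr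
  rw [hRt, hR.sum_mul_menu m] at hk2
  rw [hk2] at hk
  rw [hP2] at hfP
  linarith

theorem stmt13 {Y : Type*} [Fintype Y] [DecidableEq Y] [Nonempty Y]
    (P₀ : Y → Finset Y → ℝ) (hSCF : IsSCF P₀) (ε : ℝ) (hε0 : 0 ≤ ε) (hε1 : ε ≤ 1) :
    (∀ t : Y → Finset Y → ℕ,
      (∑ p ∈ allPairs Y, P₀ p.1 p.2 * t p.1 p.2) ≤
        (1 - ε) * (⨆ r : SLO Y, ∑ p ∈ allPairs Y, aFn r.1 p.1 p.2 * t p.1 p.2)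
          + (2 ^ Fintype.card Y - 1) * ε * (maxT t : ℝ)) ↔
    (∃ (π : SLO Y → ℝ) (R₀ : Y → Finset Y → ℝ),
      (∀ r, 0 ≤ π r) ∧ (∑ r : SLO Y, π r) = 1 ∧ IsSCF R₀ ∧
      ∀ p ∈ allPairs Y, P₀ p.1 p.2 =
        (1 - ε) * (∑ r : SLO Y, π r * aFn r.1 p.1 p.2) + ε * R₀ p.1 p.2) := by
  constructor
  · intro h
    obtain ⟨q, ⟨hπ, hR⟩, hq⟩ := exists_mixture hSCF hε0 hε1 h
    refine ⟨q.1, fun y B => q.2 (y, B), hπ.1, hπ.2,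
      fun B hB => ⟨fun y _ => hR.1.1 (y, B), hR.2 B hB⟩, fun p hp => ?_⟩
    have hqp := congrFun hq p
    rw [mixture_apply _ _ hp, if_pos hp] at hqp
    exact hqp.symm
  · rintro ⟨π, R₀, hπ0, hπ1, hR, hP⟩
    exact sum_mul_le_of_mixture hε0 hε1 hπ0 hπ1 hR hP

end
end
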